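/- For Gaussian integers x, y, z with xyz ≠ 0 and gcd(x, y, z) a unit, the equation x^4 + y^4 = i·z^2 holds if and only if x and y are units of ℤ[i] and z^2 = -2i; equivalently, the full set of nontrivial solutions is {(i^s, i^t, ±i(1+i)) : 0 ≤ s, t ≤ 3}. -/

import Mathlib

open Zsqrtd

def gI : GaussianInt := sqrtd
lemma gI_sq : gI * gI = -1 := by unfold gI; ext <;> simp [sqrtd]
def Od (x : GaussianInt) : Prop := ∃ k, x = 1 + 2 * k ∨ x = gI + 2 * k
def Ev (x : GaussianInt) : Prop := ∃ k, x = (1 + gI) * k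

lemma od_or_ev (x : GaussianInt) : Od x ∨ Ev x := by
  obtain ⟨a, b⟩ := x
  obtain ⟨a, rfl | rfl⟩ := Int.even_or_odd' a <;> obtain ⟨b, rfl | rfl⟩ := Int.even_or_odd' b
  · right; refine ⟨⟨a+b, b-a⟩, ?_⟩
    ext <;> simp [gI, sqrtd] <;> ring
  · left; refine ⟨⟨a, b⟩, Or.inr ?_⟩
    ext <;> simp [gI, sqrtd] <;> ring
  · left; refine ⟨⟨a, b⟩, Or.inl ?_⟩
    ext <;> simp [gI, sqrtd] <;> ring
  · right; refine ⟨⟨a+b+1, b-a⟩, ?_⟩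
    ext <;> simp [gI, sqrtd] <;> ring

lemma lam_ne_one (k : GaussianInt) : (1 + gI) * k ≠ 1 := by
  intro h
  have h1 := congrArg Zsqrtd.re h
  have h2 := congrArg Zsqrtd.im h
  simp [gI, sqrtd] at h1 h2
  omega

lemma two_ne (k : GaussianInt) : 2 * k ≠ 1 - gI := by
  intro h
  have h1 := congrArg Zsqrtd.re h
  simp [gI, sqrtd] at h1
  omega

lemma not_od_ev {x : GaussianInt} (h : Od x) (h' : Ev x) : False := by
  obtain ⟨k, hk⟩ := h
  obtain ⟨l, hl⟩ := h'
  have hI := gI_sq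
  rcases hk with hk | hk
  · exact lam_ne_one (l - (1 - gI) * k) (by grind)
  · exact lam_ne_one (-gI * (l - (1 - gI) * k)) (by grind)

lemma od_sq {x : GaussianInt} (h : Od x) : ∃ k l, (x = 1 + 2 * k ∧ x ^ 2 = 1 + 4 * l) ∨
    (x = gI + 2 * k ∧ x ^ 2 = -1 + 4 * l) := by
  have hI := gI_sq
  obtain ⟨k, hk | hk⟩ := h
  · exact ⟨k, k + k ^ 2, Or.inl ⟨hk, by grind⟩⟩
  · exact ⟨k, gI * k + k ^ 2, Or.inr ⟨hk, by grind⟩⟩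

lemma od_sq' {x : GaussianInt} (h : Od x) : ∃ l, x ^ 2 = 1 + 2 * l := by
  obtain ⟨k, l, ⟨_, h⟩ | ⟨_, h⟩⟩ := od_sq h
  · exact ⟨2 * l, by grind⟩
  · exact ⟨-1 + 2 * l, by grind⟩

lemma od_pow4 {x : GaussianInt} (h : Od x) : ∃ l, x ^ 4 = 1 + 8 * l := by
  obtain ⟨k, l, ⟨_, h⟩ | ⟨_, h⟩⟩ := od_sq h
  · exact ⟨l + 2 * l ^ 2, by grind⟩
  · exact ⟨-l + 2 * l ^ 2, by grind⟩

lemma unit_cases {u : GaussianInt} (h : IsUnit u) : u = 1 ∨ u = -1 ∨ u = gI ∨ u = -gI := by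
  have h1 := (Zsqrtd.norm_eq_one_iff' (by norm_num : (-1:ℤ) ≤ 0) u).2 h
  obtain ⟨a, b⟩ := u
  simp [Zsqrtd.norm_def] at h1
  have ha : a ≤ 1 := by nlinarith
  have ha' : -1 ≤ a := by nlinarith
  have hb : b ≤ 1 := by nlinarith
  have hb' : -1 ≤ b := by nlinarith
  interval_cases a <;> interval_cases b <;> simp_all [gI, sqrtd, Zsqrtd.ext_iff]


lemma two_ne_zero_gi : (2 : GaussianInt) ≠ 0 := by
  intro h
  have h1 := congrArg Zsqrtd.re h
  simp at h1

lemma od_iff {x : GaussianInt} : Od x ↔ ¬ Ev x :=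
  ⟨fun h h' => not_od_ev h h', fun h => (od_or_ev x).resolve_right h⟩

lemma od_of_sub {x k : GaussianInt} (h : x = 1 + (1 + gI) * k) : Od x := by
  rw [od_iff]
  rintro ⟨l, hl⟩
  exact lam_ne_one (l - k) (by grind)

lemma ev_of_sq {x k : GaussianInt} (h : x ^ 2 = (1 + gI) * k) : Ev x := by
  by_contra hx
  have hI := gI_sq
  obtain ⟨l, hl⟩ := od_sq' (od_iff.2 hx)
  exact lam_ne_one (k - (1 - gI) * l) (by grind)

/-- If `c²` is `i k²` then `k = 0`. -/
lemma sq_eq_I {c k : GaussianInt} (h : c ^ 2 = gI * k ^ 2) : k = 0 := by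
  by_contra hk
  have hd : k ∣ c := by
    rw [← IsIntegrallyClosed.pow_dvd_pow_iff (n := 2) two_ne_zero, h]
    exact Dvd.intro_left _ rfl
  obtain ⟨d, rfl⟩ := hd
  have h2 : d ^ 2 = gI := by
    apply mul_left_cancel₀ (pow_ne_zero 2 hk)
    grind
  obtain ⟨a, b⟩ := d
  have h1 := congrArg Zsqrtd.im h2
  simp [gI, sqrtd, pow_two] at h1
  have : 2 * (a * b) = 1 := by linarith
  omega

lemma sq_split {p q c u : GaussianInt} (hc : IsCoprime p q) (hu : IsUnit u)
    (h : p * q = u * c ^ 2) : ∃ m, p = m ^ 2 ∨ p = gI * m ^ 2 := by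
  have hI := gI_sq
  obtain ⟨d, v, hv⟩ := exists_associated_pow_of_associated_pow_mul (k := 2) (c := c) hc
    (by rw [h, mul_comm]; exact associated_mul_unit_right _ _ hu)
  rcases unit_cases v.isUnit with h1 | h1 | h1 | h1 <;> rw [h1] at hv
  · exact ⟨d, Or.inl (by grind)⟩
  · exact ⟨gI * d, Or.inl (by grind)⟩
  · exact ⟨d, Or.inr (by grind)⟩
  · exact ⟨gI * d, Or.inr (by grind)⟩

lemma unit_gI : IsUnit gI := IsUnit.of_mul_eq_one (-gI) (by have := gI_sq; grind)

lemma halve {A B n : GaussianInt} (hA : Od A) (hB : Od B) (h : A ^ 2 - B ^ 2 = 4 * n) :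
    ∃ p q, A = q + p ∧ B = q - p := by
  have hI := gI_sq
  have h2 := two_ne_zero_gi
  have bad : ∀ e : GaussianInt, 4 * e ≠ 2 := by
    intro e he
    have h1 := congrArg Zsqrtd.re he
    simp at h1
    omega
  obtain ⟨k, l, ⟨h1, h2⟩ | ⟨h1, h2⟩⟩ := od_sq hA <;>
  obtain ⟨k', l', ⟨h3, h4⟩ | ⟨h3, h4⟩⟩ := od_sq hB
  · exact ⟨k - k', 1 + k + k', by grind, by grind⟩
  · exact (bad (n - l + l') (by grind)).elim
  · exact (bad (l - l' - n) (by grind)).elim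
  · exact ⟨k - k', gI + k + k', by grind, by grind⟩

lemma od_coprime_two {x : GaussianInt} (h : Od x) : IsCoprime x 2 := by
  obtain ⟨l, hl⟩ := od_sq' h
  exact ⟨x, -l, by grind⟩

lemma step {p q r k : GaussianInt} (hc : IsCoprime p q) (ho : Od (p + q))
    (hr : p ^ 2 + q ^ 2 = r ^ 2) (hk : p * q = gI * k ^ 2) (hk0 : k ≠ 0) :
    ∃ m n t, Od m ∧ Ev n ∧ IsCoprime m n ∧ m ^ 4 - n ^ 4 = t ^ 2 ∧ (m * n) ^ 2 = k ^ 2 := by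
  have hI := gI_sq
  have fin : ∀ m n : GaussianInt, IsCoprime (m ^ 2) (gI * n ^ 2) → Od (m ^ 2 + gI * n ^ 2) →
      (m ^ 2) ^ 2 + (gI * n ^ 2) ^ 2 = r ^ 2 → m ^ 2 * (gI * n ^ 2) = gI * k ^ 2 →
      ∃ m n t, Od m ∧ Ev n ∧ IsCoprime m n ∧ m ^ 4 - n ^ 4 = t ^ 2 ∧ (m * n) ^ 2 = k ^ 2 := by
    intro m n hc ho hr hk
    have hmn : IsCoprime m n := (IsCoprime.pow_iff two_pos two_pos).1 hc.of_mul_right_right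
    have hkk : (m * n) ^ 2 = k ^ 2 := by grind
    rcases od_or_ev m with hm | hm <;> rcases od_or_ev n with hn | hn
    · exfalso
      obtain ⟨a, ha⟩ := od_sq' hm
      obtain ⟨b, hb⟩ := od_sq' hn
      exact not_od_ev ho ⟨1 + (1 - gI) * (a + gI * b), by grind⟩
    · exact ⟨m, n, r, hm, hn, hmn, by grind, hkk⟩
    · exact ⟨n, m, gI * r, hn, hm, hmn.symm, by grind, by grind⟩
    · exfalso
      obtain ⟨a, ha⟩ := hm
      obtain ⟨b, hb⟩ := hn
      exact not_od_ev ho ⟨a * m + gI * b * n, by grind⟩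
  obtain ⟨m, hm⟩ := sq_split hc unit_gI hk
  obtain ⟨n, hn⟩ := sq_split hc.symm unit_gI (by rw [mul_comm]; exact hk)
  rcases hm with rfl | rfl <;> rcases hn with rfl | rfl
  · exact (hk0 (sq_eq_I (c := m * n) (by grind))).elim
  · exact fin m n hc ho hr hk
  · exact fin n m hc.symm (by rwa [add_comm]) (by rwa [add_comm]) (by rwa [mul_comm])
  · exact (hk0 (sq_eq_I (c := gI * m * n) (by grind))).elim

lemma sq_split_od {p q c : GaussianInt} (hc : IsCoprime p q) {u : GaussianInt} (hu : IsUnit u)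
    (h : p * q = u * c ^ 2) (hp : ∃ l, p = 1 + 2 * l) : ∃ m, Od m ∧ p = m ^ 2 := by
  have hI := gI_sq
  obtain ⟨l, hl⟩ := hp
  obtain ⟨m, hm⟩ := sq_split hc hu h
  rcases od_or_ev m with ho | ⟨e, he⟩
  · rcases hm with hm | hm
    · exact ⟨m, ho, hm⟩
    · obtain ⟨a, ha⟩ := od_sq' ho
      exact (two_ne (gI * a - l) (by grind)).elim
  · rcases hm with hm | hm
    · exact (lam_ne_one (e * m - (1 - gI) * l) (by grind)).elim
    · exact (lam_ne_one (gI * e * m - (1 - gI) * l) (by grind)).elim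

lemma descent : ∀ N : ℕ, ∀ r s t : GaussianInt, s.norm.natAbs ≤ N → Od r → Ev s → IsCoprime r s →
    r ^ 4 - s ^ 4 = t ^ 2 → s = 0 := by
  intro N
  induction N with
  | zero =>
    intro r s t hN _ _ _ _
    exact GaussianInt.norm_eq_zero.1 (by omega)
  | succ N ih =>
    intro r s t hN hr hs hc h
    by_contra hs0
    have hI := gI_sq
    have h2 := two_ne_zero_gi
    obtain ⟨k, hk⟩ := hs
    obtain ⟨l, hl⟩ := od_sq' hr
    have e1 : r ^ 2 + s ^ 2 = 1 + 2 * (l + gI * k ^ 2) := by grind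
    have e2 : r ^ 2 - s ^ 2 = 1 + 2 * (l - gI * k ^ 2) := by grind
    have o1 : Od (r ^ 2 + s ^ 2) := ⟨_, Or.inl e1⟩
    have hc2 : IsCoprime (r ^ 2) (s ^ 2) := hc.pow
    have c1 : IsCoprime (r ^ 2 + s ^ 2) (r ^ 2 - s ^ 2) := by
      have d1 : IsCoprime (r ^ 2 + s ^ 2) (r ^ 2) := by
        obtain ⟨a, b, hab⟩ := hc2
        exact ⟨b, a - b, by grind⟩
      obtain ⟨a, b, hab⟩ := (od_coprime_two o1).mul_right d1
      exact ⟨a + b, b, by grind⟩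
    obtain ⟨A, hA, hA2⟩ := sq_split_od (c := t) c1 isUnit_one (by grind) ⟨_, e1⟩
    obtain ⟨B, hB, hB2⟩ := sq_split_od (c := t) c1.symm isUnit_one (by grind) ⟨_, e2⟩
    obtain ⟨p, q, hp, hq⟩ := halve (n := gI * k ^ 2) hA hB (by grind)
    have hpq : p * q = gI * k ^ 2 := by
      apply mul_left_cancel₀ (mul_ne_zero h2 h2)
      grind
    have hr2 : p ^ 2 + q ^ 2 = r ^ 2 := by
      apply mul_left_cancel₀ h2
      grind
    have hcpq : IsCoprime p q := by
      obtain ⟨a, b, hab⟩ := hc2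
      exact ⟨a * p + 2 * b * q, a * q, by grind⟩
    have hk0 : k ≠ 0 := by rintro rfl; simp at hk; exact hs0 hk
    obtain ⟨m, n, t', hm, hn, hmn, ht, hmnk⟩ := step hcpq (by rwa [add_comm, ← hp]) hr2 hpq hk0
    have hmn0 : m * n ≠ 0 := by
      intro h0
      rw [h0] at hmnk
      exact hk0 (by simpa using hmnk.symm)
    have hn0 : n = 0 := by
      refine ih m n t' ?_ hm hn hmn ht
      have n1 : s.norm = 2 * k.norm := by
        rw [hk, Zsqrtd.norm_mul]
        congr 1
      have n2 : m.norm * n.norm = k.norm := by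
        have := sq_eq_sq_iff_eq_or_eq_neg.1 hmnk
        rw [← Zsqrtd.norm_mul]
        rcases this with h | h <;> rw [h]
        simp
      have p1 := GaussianInt.norm_pos.2 (left_ne_zero_of_mul hmn0)
      have p2 := GaussianInt.norm_pos.2 (right_ne_zero_of_mul hmn0)
      have : n.norm ≤ k.norm := by nlinarith
      omega
    exact hmn0 (by rw [hn0, mul_zero])

lemma lemC {a b c n : GaussianInt} (ha : Od a) (hb : Od b) (hab : IsCoprime a b)
    (hn : a ^ 2 - b ^ 2 = 4 * n) (h : a ^ 4 - b ^ 4 = c ^ 2) : a ^ 2 = b ^ 2 := by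
  have hI := gI_sq
  have h2 := two_ne_zero_gi
  obtain ⟨p, q, hp, hq⟩ := halve ha hb hn
  suffices hpq : p * q = 0 by grind
  have hcpq : IsCoprime p q := by
    obtain ⟨u, v, huv⟩ := hab
    exact ⟨u - v, u + v, by grind⟩
  have hopq : Od (p + q) := by rwa [add_comm, ← hp]
  have hc8 : c ^ 2 = 8 * (p * q * (p ^ 2 + q ^ 2)) := by grind
  obtain ⟨c1, hc1⟩ := ev_of_sq (x := c) (k := (1 - gI) * 4 * (p * q * (p ^ 2 + q ^ 2))) (by grind)
  have hc1' : c1 ^ 2 = -4 * gI * (p * q * (p ^ 2 + q ^ 2)) := by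
    apply mul_left_cancel₀ h2
    grind
  obtain ⟨c2, hc2⟩ := ev_of_sq (x := c1) (k := (1 - gI) * (-2) * gI * (p * q * (p ^ 2 + q ^ 2)))
    (by grind)
  have hc2' : c2 ^ 2 = -2 * (p * q * (p ^ 2 + q ^ 2)) := by
    apply mul_left_cancel₀ h2
    grind
  obtain ⟨c3, hc3⟩ := ev_of_sq (x := c2) (k := (1 - gI) * (-1) * (p * q * (p ^ 2 + q ^ 2)))
    (by grind)
  have hc3' : (p ^ 2 + q ^ 2) * (p * q) = (-gI) * c3 ^ 2 := by
    apply mul_left_cancel₀ h2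
    grind
  have hg : ∃ l, p ^ 2 + q ^ 2 = 1 + 2 * l := by
    obtain ⟨l, hl⟩ := od_sq' hopq
    exact ⟨l - p * q, by grind⟩
  have hcg : IsCoprime (p ^ 2 + q ^ 2) (p * q) := by
    apply IsCoprime.mul_right
    · obtain ⟨u, v, huv⟩ := (hcpq.symm.pow_left (m := 2))
      exact ⟨u, v - u * p, by grind⟩
    · obtain ⟨u, v, huv⟩ := (hcpq.pow_left (m := 2))
      exact ⟨u, v - u * q, by grind⟩
  obtain ⟨t, hto, ht⟩ := sq_split_od hcg unit_gI.neg hc3' hg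
  have ht0 : t ≠ 0 := by
    rintro rfl
    exact not_od_ev hto ⟨0, by simp⟩
  have htc : t ∣ c3 := by
    rw [← IsIntegrallyClosed.pow_dvd_pow_iff (n := 2) two_ne_zero]
    refine ⟨gI * (p * q), ?_⟩
    grind
  obtain ⟨j, hj⟩ := htc
  have hpq : p * q = gI * (gI * j) ^ 2 := by
    apply mul_left_cancel₀ (pow_ne_zero 2 ht0)
    grind
  by_cases hj0 : gI * j = 0
  · rw [hpq, hj0]; simp
  obtain ⟨m, n, t', hm, hn, hmn, ht', hmnk⟩ := step hcpq hopq ht hpq hj0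
  have := descent _ m n t' le_rfl hm hn hmn ht'
  rw [this] at hmnk
  exact (hj0 (by simpa using hmnk.symm)).elim

lemma lemC' {a b c : GaussianInt} (ha : Od a) (hb : Od b) (hab : IsCoprime a b)
    (h : a ^ 4 - b ^ 4 = c ^ 2) : a ^ 2 = b ^ 2 ∨ a ^ 2 = - b ^ 2 := by
  have hI := gI_sq
  obtain ⟨k, l, h1⟩ := od_sq ha
  obtain ⟨k', l', h3⟩ := od_sq hb
  have hib : Od (gI * b) := by
    rw [od_iff]
    rintro ⟨e, he⟩
    exact not_od_ev hb ⟨-gI * e, by grind⟩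
  have hcib : IsCoprime a (gI * b) := (isCoprime_mul_unit_left_right unit_gI a b).2 hab
  rcases h1 with ⟨_, h1⟩ | ⟨_, h1⟩ <;> rcases h3 with ⟨_, h3⟩ | ⟨_, h3⟩
  · exact Or.inl (lemC (n := l - l') ha hb hab (by grind) h)
  · have := lemC (n := l + l') (c := c) ha hib hcib (by grind) (by grind)
    right; grind
  · have := lemC (n := l + l') (c := c) ha hib hcib (by grind) (by grind)
    right; grind
  · exact Or.inl (lemC (n := l - l') ha hb hab (by grind) h)

lemma unit_pow4 {u : GaussianInt} (h : IsUnit u) : u ^ 4 = 1 := by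
  have hI := gI_sq
  rcases unit_cases h with h | h | h | h <;> grind

lemma mixed {x y z : GaussianInt} (hx : Od x) (hy : Ev y) (h : x ^ 4 + y ^ 4 = gI * z ^ 2) :
    False := by
  have hI := gI_sq
  obtain ⟨a, ha⟩ := od_pow4 hx
  obtain ⟨b, hb⟩ := hy
  rcases od_or_ev z with hz | ⟨e, he⟩
  · obtain ⟨c, hc⟩ := od_sq' hz
    exact two_ne (gI * c - 4 * a + 2 * b ^ 4) (by grind)
  · exact lam_ne_one (gI * e * z - (1 - gI) * 4 * a - b * y ^ 3) (by grind)

lemma both_od {x y z : GaussianInt} (hc : IsCoprime x y) (hx : Od x) (hy : Od y)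
    (h : x ^ 4 + y ^ 4 = gI * z ^ 2) : IsUnit x ∧ IsUnit y := by
  have hI := gI_sq
  have h2 := two_ne_zero_gi
  obtain ⟨a, ha⟩ := od_pow4 hx
  obtain ⟨b, hb⟩ := od_pow4 hy
  obtain ⟨w, hw⟩ := ev_of_sq (x := z) (k := -gI * (1 - gI) * (1 + 4 * a + 4 * b)) (by grind)
  have h1 : x ^ 4 + y ^ 4 = -2 * w ^ 2 := by grind
  have hwo : Od w := by
    rw [od_iff]
    rintro ⟨e, he⟩
    refine lam_ne_one (-e * w - (1 - gI) * (2 * a + 2 * b)) ?_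
    apply mul_left_cancel₀ h2
    grind
  have hxyo : Od (x * y) := by
    rw [od_iff]
    intro hev
    obtain ⟨e, he⟩ := hev
    obtain ⟨c, hc⟩ := od_sq' hx
    obtain ⟨d, hd⟩ := od_sq' hy
    exact lam_ne_one (e * (x * y) - (1 - gI) * (c + d + 2 * c * d)) (by
      linear_combination (-(x * y)) * he + y ^ 2 * hc + (1 + 2 * c) * hd + (c + d + 2 * c * d) * hI)
  have hcw : IsCoprime w (x * y) := by
    apply IsCoprime.mul_right
    · obtain ⟨u, v, huv⟩ := hc.symm.pow_left (m := 4)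
      exact ⟨-2 * u * w, v - u * x ^ 3, by grind⟩
    · obtain ⟨u, v, huv⟩ := hc.pow_left (m := 4)
      exact ⟨-2 * u * w, v - u * y ^ 3, by grind⟩
  have key := lemC' (c := 4 * (a - b)) hwo hxyo hcw (by
    apply mul_left_cancel₀ (mul_ne_zero h2 h2)
    grind)
  have hxy : x ^ 2 ∣ y ^ 2 ∧ y ^ 2 ∣ x ^ 2 := by
    rcases key with key | key
    · have : (x ^ 2 + y ^ 2) ^ 2 = 0 := by grind
      have h3 : x ^ 2 + y ^ 2 = 0 := by simpa using this
      exact ⟨⟨-1, by grind⟩, ⟨-1, by grind⟩⟩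
    · have : (x ^ 2 - y ^ 2) ^ 2 = 0 := by grind
      have h3 : x ^ 2 - y ^ 2 = 0 := by simpa using this
      exact ⟨⟨1, by grind⟩, ⟨1, by grind⟩⟩
  have hc2 : IsCoprime (x ^ 2) (y ^ 2) := hc.pow
  exact ⟨(isUnit_pow_iff two_ne_zero).1 (hc2.isUnit_of_dvd hxy.1),
    (isUnit_pow_iff two_ne_zero).1 (hc2.symm.isUnit_of_dvd hxy.2)⟩




/-- For Gaussian integers `x, y, z` with `x * y * z ≠ 0` and `gcd (x, y, z)` a
unit, the equation `x⁴ + y⁴ = i·z²` holds if and only if `x` and `y` are units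
of `ℤ[i]` and `z ^ 2 = -2i` (i.e. `z = ± i(1+i)`). -/
theorem nontrivial_solutions_x4_add_y4_eq_i_z2_iff
    (x y z : GaussianInt) (hxyz : x * y * z ≠ 0)
    (hgcd : ∀ d : GaussianInt, d ∣ x → d ∣ y → d ∣ z → IsUnit d) :
    x ^ 4 + y ^ 4 = sqrtd * z ^ 2 ↔
      IsUnit x ∧ IsUnit y ∧ z ^ 2 = -2 * sqrtd := by
  have hI := gI_sq
  change x ^ 4 + y ^ 4 = gI * z ^ 2 ↔ IsUnit x ∧ IsUnit y ∧ z ^ 2 = -2 * gI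
  constructor
  · intro h
    have hc : IsCoprime x y := by
      apply isCoprime_of_dvd
      · rintro ⟨rfl, rfl⟩
        simp at hxyz
      · intro d hd _ hdx hdy
        refine hd (hgcd d hdx hdy ?_)
        have h1 : d ^ 2 ∣ z ^ 2 := by
          obtain ⟨a, rfl⟩ := hdx
          obtain ⟨b, rfl⟩ := hdy
          exact ⟨-gI * d ^ 2 * (a ^ 4 + b ^ 4), by grind⟩
        exact (IsIntegrallyClosed.pow_dvd_pow_iff two_ne_zero).1 h1
    have hu : IsUnit x ∧ IsUnit y := by
      rcases od_or_ev x with hx | hx <;> rcases od_or_ev y with hy | hy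
      · exact both_od hc hx hy h
      · exact (mixed hx hy h).elim
      · exact (mixed hy hx (by rwa [add_comm])).elim
      · exfalso
        obtain ⟨u, v, huv⟩ := hc
        obtain ⟨a, ha⟩ := hx
        obtain ⟨b, hb⟩ := hy
        exact lam_ne_one (u * a + v * b) (by grind)
    refine ⟨hu.1, hu.2, ?_⟩
    have h1 := unit_pow4 hu.1
    have h2 := unit_pow4 hu.2
    grind
  · rintro ⟨hx, hy, hz⟩
    have h1 := unit_pow4 hx
    have h2 := unit_pow4 hy
    grind
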